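/- arXiv:1411.3198 — 3 statements merged into one kernel-verified Lean document; each statement's English description precedes it below -/
import Mathlib

section
/- In the polynomial ring 𝔽₂[x_1, …, x_n] (n ≥ 1), let E := ∏_{S ⊆ {1,…,n}, |S| even} (1 + σ_S), let O := ∏_{S ⊆ {1,…,n}, |S| odd} (1 + σ_S), and let P := ∏_{S ⊆ {1,…,n}, |S| odd} σ_S. Then there exists a polynomial g ∈ 𝔽₂[x_1, …, x_n] whose constant coefficient is 1 such that E + O = P·g. (In particular, P divides E + O, and all homogeneous components of E + O of degree strictly between 0 and 2^{n−1} vanish.) -/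
open MvPolynomial

/-- In characteristic two, the product of `t + v` over all subset sums `v` of a family `a`
is additive in `t`. -/
lemma prod_powerset_add_sum_add {R ι : Type*} [CommRing R] [CharP R 2] [DecidableEq ι]
    (a : ι → R) (s : Finset ι) (t u : R) :
    ∏ A ∈ s.powerset, (t + u + ∑ i ∈ A, a i) =
      ∏ A ∈ s.powerset, (t + ∑ i ∈ A, a i) + ∏ A ∈ s.powerset, (u + ∑ i ∈ A, a i) := by
  induction s using Finset.induction_on generalizing t u with
  | empty => simp
  | insert j s hj ih =>
    have step (t : R) : ∏ A ∈ (insert j s).powerset, (t + ∑ i ∈ A, a i) =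
        (∏ A ∈ s.powerset, (t + ∑ i ∈ A, a i)) *
          (∏ A ∈ s.powerset, (t + ∑ i ∈ A, a i) + ∏ A ∈ s.powerset, (a j + ∑ i ∈ A, a i)) := by
      rw [Finset.prod_powerset_insert hj, ← ih]
      congr 1
      refine Finset.prod_congr rfl fun A hA => ?_
      rw [Finset.sum_insert fun h => hj (Finset.mem_powerset.mp hA h), add_assoc]
    rw [step, step, step, ih]
    linear_combination (∏ A ∈ s.powerset, (t + ∑ i ∈ A, a i)) *
      (∏ A ∈ s.powerset, (u + ∑ i ∈ A, a i)) * CharTwo.two_eq_zero (R := R)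

/-- If `p` holds for exactly one of `A` and `insert j A` whenever `j ∉ A`, then a product over
the sets satisfying `p` is a product over the sets avoiding `j`. -/
lemma prod_filter_eq_prod_powerset_erase {M ι : Type*} [CommMonoid M] [Fintype ι] [DecidableEq ι]
    (p : Finset ι → Prop) [DecidablePred p] (j : ι)
    (hp : ∀ A, j ∉ A → (p (insert j A) ↔ ¬ p A)) (f : Finset ι → M) :
    ∏ S ∈ Finset.univ.filter p, f S =
      ∏ A ∈ (Finset.univ.erase j).powerset, if p A then f A else f (insert j A) := by
  rw [Finset.prod_filter, ← Finset.powerset_univ, ← Finset.insert_erase (Finset.mem_univ j),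
    Finset.prod_powerset_insert (Finset.notMem_erase j _), ← Finset.prod_mul_distrib,
    Finset.erase_insert (Finset.notMem_erase j _)]
  refine Finset.prod_congr rfl fun A hA => ?_
  have hj : j ∉ A := fun h => Finset.notMem_erase j _ (Finset.mem_powerset.mp hA h)
  by_cases h : p A <;> simp [hp A hj, h]

lemma sum_add_const_of_charTwo {R ι : Type*} [CommRing R] [CharP R 2] (a : ι → R) (j : ι)
    (A : Finset ι) :
    ∑ i ∈ A, (a i + a j) = ∑ i ∈ A, a i + if Even A.card then 0 else a j := by
  rw [Finset.sum_add_distrib, Finset.sum_const, nsmul_eq_mul]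
  split_ifs with h
  · simp [(CharP.cast_eq_zero_iff R 2 A.card).mpr h.two_dvd]
  · obtain ⟨k, hk⟩ := Nat.not_even_iff_odd.mp h
    simp [hk, CharTwo.two_eq_zero]

section ParityProducts

variable {R ι : Type*} [CommRing R] [CharP R 2] [Fintype ι] [DecidableEq ι]

lemma prod_even_card_add_sum (a : ι → R) (j : ι) (t : R) :
    ∏ S ∈ Finset.univ.filter (fun S : Finset ι => Even S.card), (t + ∑ i ∈ S, a i) =
      ∏ A ∈ (Finset.univ.erase j).powerset, (t + ∑ i ∈ A, (a i + a j)) := by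
  rw [prod_filter_eq_prod_powerset_erase _ j
    (fun A hA => by rw [Finset.card_insert_of_notMem hA, Nat.even_add_one])]
  refine Finset.prod_congr rfl fun A hA => ?_
  have hj : j ∉ A := fun h => Finset.notMem_erase j _ (Finset.mem_powerset.mp hA h)
  rw [sum_add_const_of_charTwo, Finset.sum_insert hj]
  split_ifs <;> ring

lemma prod_odd_card_add_sum (a : ι → R) (j : ι) (t : R) :
    ∏ S ∈ Finset.univ.filter (fun S : Finset ι => Odd S.card), (t + ∑ i ∈ S, a i) =
      ∏ A ∈ (Finset.univ.erase j).powerset, (t + a j + ∑ i ∈ A, (a i + a j)) := by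
  rw [prod_filter_eq_prod_powerset_erase _ j
    (fun A hA => by rw [Finset.card_insert_of_notMem hA, Nat.odd_add_one])]
  refine Finset.prod_congr rfl fun A hA => ?_
  have hj : j ∉ A := fun h => Finset.notMem_erase j _ (Finset.mem_powerset.mp hA h)
  rw [sum_add_const_of_charTwo, Finset.sum_insert hj]
  by_cases h : Even A.card
  · simp only [Nat.not_odd_iff_even.mpr h, h, if_true, if_false]
    ring
  · simp only [Nat.not_even_iff_odd.mp h, h, if_true, if_false]
    linear_combination -a j * CharTwo.two_eq_zero (R := R)

/-- Over a nonempty index set, the products of `t + v` over the even and over the odd subset sums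
`v` differ by the product of the odd subset sums. -/
lemma prod_even_card_add_prod_odd_card [Nonempty ι] (a : ι → R) (t : R) :
    ∏ S ∈ Finset.univ.filter (fun S : Finset ι => Even S.card), (t + ∑ i ∈ S, a i) +
        ∏ S ∈ Finset.univ.filter (fun S : Finset ι => Odd S.card), (t + ∑ i ∈ S, a i) =
      ∏ S ∈ Finset.univ.filter (fun S : Finset ι => Odd S.card), ∑ i ∈ S, a i := by
  obtain ⟨j⟩ := ‹Nonempty ι›
  have hodd := prod_odd_card_add_sum a j 0
  simp only [zero_add] at hodd
  rw [prod_even_card_add_sum a j, prod_odd_card_add_sum a j, hodd, prod_powerset_add_sum_add,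
    ← add_assoc, CharTwo.add_self_eq_zero, zero_add]

end ParityProducts

/-- In `𝔽₂[x_1, …, x_n]` (`n ≥ 1`), with `E := ∏_{|S| even} (1 + σ_S)`,
`O := ∏_{|S| odd} (1 + σ_S)` and `P := ∏_{|S| odd} σ_S` (where `σ_S = ∑_{i ∈ S} x_i`),
there exists a polynomial `g` with constant coefficient `1` such that `E + O = P·g`. -/
theorem milnor_divisibility (n : ℕ) (hn : 1 ≤ n) :
    ∃ g : MvPolynomial (Fin n) (ZMod 2),
      MvPolynomial.coeff 0 g = 1 ∧
      (∏ S ∈ Finset.univ.filter (fun S : Finset (Fin n) => Even S.card),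
          (1 + ∑ i ∈ S, (X i : MvPolynomial (Fin n) (ZMod 2))))
        + (∏ S ∈ Finset.univ.filter (fun S : Finset (Fin n) => Odd S.card),
            (1 + ∑ i ∈ S, (X i : MvPolynomial (Fin n) (ZMod 2))))
      = (∏ S ∈ Finset.univ.filter (fun S : Finset (Fin n) => Odd S.card),
          (∑ i ∈ S, (X i : MvPolynomial (Fin n) (ZMod 2)))) * g := by
  have : Nonempty (Fin n) := ⟨⟨0, hn⟩⟩
  refine ⟨1, by simp, ?_⟩
  rw [mul_one]
  exact prod_even_card_add_prod_odd_card _ _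
end

section
/- In the polynomial ring 𝔽₂[x_1, …, x_n] (n ≥ 1), the following identity holds: ∏_{S ⊆ {1,…,n}, |S| odd} σ_S = ∑ x_1^{2^{r_1}}·x_2^{2^{r_2}}·⋯·x_n^{2^{r_n}}, where the sum runs over all n-tuples (r_1, …, r_n) of nonnegative integers satisfying 2^{r_1} + 2^{r_2} + ⋯ + 2^{r_n} = 2^{n−1}. -/
open MvPolynomial

theorem Nat.sum_digits_two_eq (m : ℕ) :
    (Nat.digits 2 m).sum = m % 2 + (Nat.digits 2 (m / 2)).sum := by
  rcases Nat.eq_zero_or_pos m with rfl | h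
  · simp
  · rw [Nat.digits_def' (by norm_num) h, List.sum_cons]

theorem Nat.sum_digits_two_add_two_pow_le (r m : ℕ) :
    (Nat.digits 2 (2 ^ r + m)).sum ≤ (Nat.digits 2 m).sum + 1 := by
  induction r generalizing m with
  | zero =>
    induction m using Nat.strong_induction_on with
    | _ m ih =>
      rw [Nat.sum_digits_two_eq, Nat.sum_digits_two_eq m]
      rcases Nat.mod_two_eq_zero_or_one m with h | h
      · have : (2 ^ 0 + m) / 2 = m / 2 := by omega
        rw [this]; omega
      · have : (2 ^ 0 + m) / 2 = 2 ^ 0 + m / 2 := by omega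
        have := ih (m / 2) (by omega)
        grind
  | succ r ih =>
    rw [Nat.sum_digits_two_eq, Nat.sum_digits_two_eq m]
    have : (2 ^ (r + 1) + m) / 2 = 2 ^ r + m / 2 := by omega
    have := ih (m / 2)
    grind

theorem Nat.sum_digits_two_two_pow_sub_one (n : ℕ) :
    (Nat.digits 2 (2 ^ n - 1)).sum = n := by
  induction n with
  | zero => simp
  | succ n ih =>
    have : 0 < 2 ^ n := by positivity
    rw [Nat.sum_digits_two_eq, show (2 ^ (n + 1) - 1) / 2 = 2 ^ n - 1 by omega, ih]
    omega

theorem Finset.card_filter_even_powerset {ι : Type*} {s : Finset ι} (hs : s.Nonempty) :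
    (s.powerset.filter fun t => Even t.card).card = 2 ^ (s.card - 1) := by
  classical
  obtain ⟨a, ha⟩ := hs
  obtain ⟨u, hau, rfl⟩ : ∃ u, a ∉ u ∧ insert a u = s :=
    ⟨s.erase a, Finset.notMem_erase a s, Finset.insert_erase ha⟩
  rw [Finset.card_filter, Finset.sum_powerset_insert hau, ← Finset.sum_add_distrib,
    Finset.card_insert_of_notMem hau, Nat.add_sub_cancel, ← Finset.card_powerset,
    Finset.card_eq_sum_ones]
  refine Finset.sum_congr rfl fun t ht => ?_
  rw [Finset.card_insert_of_notMem fun h => hau (Finset.mem_powerset.1 ht h)]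
  by_cases h : Even t.card <;> simp [h, Nat.even_add_one]

section
variable {R : Type*} [CommRing R]

open Classical in
/-- The power series `∑ᵣ (a t) ^ 2 ^ r`. -/
noncomputable def twoPowSeries (a : R) : PowerSeries R :=
  PowerSeries.mk fun m => if ∃ r, 2 ^ r = m then a ^ m else 0

open Classical in
theorem coeff_twoPowSeries (a : R) (m : ℕ) :
    PowerSeries.coeff m (twoPowSeries a) = if ∃ r, 2 ^ r = m then a ^ m else 0 :=
  PowerSeries.coeff_mk _ _

theorem twoPowSeries_zero : twoPowSeries (0 : R) = 0 := by
  ext m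
  rw [coeff_twoPowSeries]
  split_ifs with h
  · obtain ⟨r, rfl⟩ := h
    simp
  · simp

theorem coeff_prod_twoPowSeries_eq_zero {ι : Type*} (x : ι → R) (s : Finset ι) (m : ℕ)
    (hm : s.card < (Nat.digits 2 m).sum) :
    PowerSeries.coeff m (∏ i ∈ s, twoPowSeries (x i)) = 0 := by
  classical
  induction s using Finset.induction_on generalizing m with
  | empty =>
    have : m ≠ 0 := by rintro rfl; simp at hm
    simp [PowerSeries.coeff_one, this]
  | insert a s ha ih =>
    rw [Finset.prod_insert ha, PowerSeries.coeff_mul]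
    refine Finset.sum_eq_zero fun p hp => ?_
    rw [Finset.HasAntidiagonal.mem_antidiagonal] at hp
    rw [Finset.card_insert_of_notMem ha] at hm
    rw [coeff_twoPowSeries]
    split_ifs with h
    · obtain ⟨r, hr⟩ := h
      have := Nat.sum_digits_two_add_two_pow_le r p.2
      rw [hr, hp] at this
      rw [ih _ (by omega), mul_zero]
    · rw [zero_mul]

theorem coeff_prod_twoPowSeries_of_lt_card {ι : Type*} (x : ι → R) (s : Finset ι) (m : ℕ)
    (hm : m < s.card) :
    PowerSeries.coeff m (∏ i ∈ s, twoPowSeries (x i)) = 0 := by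
  classical
  induction s using Finset.induction_on generalizing m with
  | empty => simp at hm
  | insert a s ha ih =>
    rw [Finset.prod_insert ha, PowerSeries.coeff_mul]
    refine Finset.sum_eq_zero fun p hp => ?_
    rw [Finset.HasAntidiagonal.mem_antidiagonal] at hp
    rw [Finset.card_insert_of_notMem ha] at hm
    rw [coeff_twoPowSeries]
    split_ifs with h
    · obtain ⟨r, hr⟩ := h
      have : 0 < 2 ^ r := by positivity
      rw [ih _ (by omega), mul_zero]
    · rw [zero_mul]

variable [CharP R 2]

theorem twoPowSeries_add (a b : R) :
    twoPowSeries (a + b) = twoPowSeries a + twoPowSeries b := by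
  ext m
  simp only [map_add, coeff_twoPowSeries]
  split_ifs with h
  · obtain ⟨r, rfl⟩ := h
    exact add_pow_char_pow a b 2 r
  · simp

theorem twoPowSeries_sum {ι : Type*} (x : ι → R) (s : Finset ι) :
    twoPowSeries (∑ i ∈ s, x i) = ∑ i ∈ s, twoPowSeries (x i) := by
  classical
  induction s using Finset.induction_on with
  | empty => simp [twoPowSeries_zero]
  | insert a s ha ih => rw [Finset.sum_insert ha, Finset.sum_insert ha, twoPowSeries_add, ih]

theorem twoPowSeries_mul_self (a : R) :
    twoPowSeries a * twoPowSeries a = twoPowSeries a + PowerSeries.C a * PowerSeries.X := by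
  classical
  ext m
  rw [PowerSeries.coeff_mul, ← Finset.sum_filter_add_sum_filter_not _ (fun p => p.1 = p.2)]
  have hoff : ∑ p ∈ (Finset.HasAntidiagonal.antidiagonal m).filter (fun p => ¬ p.1 = p.2),
      PowerSeries.coeff p.1 (twoPowSeries a) * PowerSeries.coeff p.2 (twoPowSeries a) = 0 := by
    refine Finset.sum_involution (fun p _ => p.swap) ?_ ?_ ?_ ?_
    · intro p _
      rw [Prod.fst_swap, Prod.snd_swap, mul_comm, CharTwo.add_self_eq_zero]
    · intro p hp _ h
      exact (Finset.mem_filter.1 hp).2 (congrArg Prod.snd h)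
    · intro p hp
      rw [Finset.mem_filter, Finset.HasAntidiagonal.mem_antidiagonal] at *
      exact ⟨by rw [add_comm]; exact hp.1, fun h => hp.2 h.symm⟩
    · intro p _
      exact p.swap_swap
  rw [hoff, add_zero, map_add, PowerSeries.coeff_C_mul, PowerSeries.coeff_X]
  rcases Nat.even_or_odd' m with ⟨k, rfl | rfl⟩
  · have : (Finset.HasAntidiagonal.antidiagonal (2 * k)).filter (fun p => p.1 = p.2) = {(k, k)} := by
      ext ⟨i, j⟩
      simp only [Finset.mem_filter, Finset.HasAntidiagonal.mem_antidiagonal, Finset.mem_singleton, Prod.mk.injEq]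
      omega
    rw [this, Finset.sum_singleton, coeff_twoPowSeries, coeff_twoPowSeries,
      if_neg (show ¬ 2 * k = 1 by omega), mul_zero, add_zero]
    have : (∃ r, 2 ^ r = 2 * k) ↔ ∃ r, 2 ^ r = k := by
      constructor
      · rintro ⟨r, hr⟩
        cases r with
        | zero => omega
        | succ r => exact ⟨r, by omega⟩
      · rintro ⟨r, rfl⟩
        exact ⟨r + 1, by ring⟩
    rw [if_congr this rfl rfl]
    split_ifs
    · ring
    · simp
  · have : (Finset.HasAntidiagonal.antidiagonal (2 * k + 1)).filter (fun p => p.1 = p.2) = ∅ := by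
      ext ⟨i, j⟩
      simp only [Finset.mem_filter, Finset.HasAntidiagonal.mem_antidiagonal, Finset.notMem_empty, iff_false]
      omega
    rw [this, Finset.sum_empty, coeff_twoPowSeries]
    have : (∃ r, 2 ^ r = 2 * k + 1) ↔ 2 * k + 1 = 1 := by
      constructor
      · rintro ⟨r, hr⟩
        cases r with
        | zero => omega
        | succ r => omega
      · intro h
        exact ⟨0, by omega⟩
    rw [if_congr this rfl rfl]
    split_ifs with h
    · rw [h, pow_one, mul_one, CharTwo.add_self_eq_zero]
    · simp

theorem coeff_twoPowSeries_sum_mul_prod_eq_zero {ι : Type*} (x : ι → R) {s t : Finset ι}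
    (hts : t ⊆ s) (ht : Even t.card) :
    PowerSeries.coeff (2 ^ s.card)
      (twoPowSeries (∑ i ∈ t, x i) * ∏ i ∈ s, twoPowSeries (x i)) = 0 := by
  classical
  have key : ∀ j ∈ t, PowerSeries.coeff (2 ^ s.card)
      (twoPowSeries (x j) * ∏ i ∈ s, twoPowSeries (x i)) =
      PowerSeries.coeff (2 ^ s.card) (∏ i ∈ s, twoPowSeries (x i)) := by
    intro j hj
    have hcard := Finset.card_erase_add_one (hts hj)
    rw [← Finset.mul_prod_erase s _ (hts hj), ← mul_assoc, twoPowSeries_mul_self, add_mul,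
      map_add, mul_assoc, PowerSeries.coeff_C_mul,
      ← Nat.sub_add_cancel (Nat.one_le_two_pow (n := s.card)), mul_comm PowerSeries.X,
      PowerSeries.coeff_succ_mul_X, coeff_prod_twoPowSeries_eq_zero, mul_zero, add_zero]
    rw [Nat.sum_digits_two_two_pow_sub_one]
    omega
  rw [twoPowSeries_sum, Finset.sum_mul, map_sum, Finset.sum_congr rfl key, Finset.sum_const,
    nsmul_eq_mul, (CharP.cast_eq_zero_iff R 2 _).2 ht.two_dvd, zero_mul]

open Polynomial in
theorem coeff_twoPowSeries_mul_prod [IsDomain R] {ι : Type*} (x : ι → R) {s : Finset ι}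
    (hs : s.Nonempty) (hx : Set.InjOn (fun t : Finset ι => ∑ i ∈ t, x i) s.powerset) (a : R) :
    PowerSeries.coeff (2 ^ s.card) (twoPowSeries a * ∏ i ∈ s, twoPowSeries (x i)) =
      PowerSeries.coeff (2 ^ (s.card - 1)) (∏ i ∈ s, twoPowSeries (x i)) *
        ∏ t ∈ s.powerset with Even t.card, (a + ∑ i ∈ t, x i) := by
  classical
  obtain ⟨n, hn⟩ : ∃ n, s.card = n + 1 := ⟨s.card - 1, by have := hs.card_pos; omega⟩
  set G := ∏ i ∈ s, twoPowSeries (x i)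
  let f : R[X] := ∑ p ∈ Finset.HasAntidiagonal.antidiagonal (2 ^ s.card),
    if ∃ r, 2 ^ r = p.1 then Polynomial.C (PowerSeries.coeff p.2 G) * Polynomial.X ^ p.1 else 0
  have hf : ∀ b, f.eval b = PowerSeries.coeff (2 ^ s.card) (twoPowSeries b * G) := by
    intro b
    rw [PowerSeries.coeff_mul, eval_finsetSum]
    refine Finset.sum_congr rfl fun p _ => ?_
    rw [coeff_twoPowSeries]
    split_ifs
    · rw [Polynomial.eval_mul, Polynomial.eval_C, Polynomial.eval_pow, Polynomial.eval_X, mul_comm]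
    · simp
  let E := s.powerset.filter fun t => Even t.card
  have hE : E.card = 2 ^ n := by rw [Finset.card_filter_even_powerset hs, hn, Nat.add_sub_cancel]
  let g : R[X] := ∏ t ∈ E, (Polynomial.X - Polynomial.C (∑ i ∈ t, x i))
  have hgm : g.Monic := monic_prod_of_monic _ _ fun t _ => monic_X_sub_C _
  have hgd : g.natDegree = 2 ^ n := by
    rw [natDegree_prod_of_monic _ _ fun t _ => monic_X_sub_C _]
    simp only [natDegree_X_sub_C, Finset.sum_const, hE, smul_eq_mul, mul_one]
  have hcoeff : ∀ m, 2 ^ n ≤ m →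
      f.coeff m = if m = 2 ^ n then PowerSeries.coeff (2 ^ n) G else 0 := by
    intro m hm
    rw [finsetSum_coeff, Finset.sum_eq_single (2 ^ n, 2 ^ n)]
    · rw [if_pos ⟨n, rfl⟩, Polynomial.coeff_C_mul, Polynomial.coeff_X_pow]
      simp
    · rintro ⟨i, j⟩ hp hne
      rw [Finset.HasAntidiagonal.mem_antidiagonal] at hp
      dsimp only at hp ⊢
      split_ifs with h
      · obtain ⟨r, rfl⟩ := h
        rw [Polynomial.coeff_C_mul, Polynomial.coeff_X_pow]
        split_ifs with hmr
        · have hnr : n ≤ r := (Nat.pow_le_pow_iff_right (by norm_num)).1 (hmr ▸ hm)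
          rcases hnr.eq_or_lt with rfl | hlt
          · exfalso
            apply hne
            rw [hn] at hp
            ext <;> simp; omega
          · have h1 : 2 ^ (n + 1) ≤ 2 ^ r := Nat.pow_le_pow_right (by norm_num) hlt
            rw [hn] at hp
            rw [coeff_prod_twoPowSeries_of_lt_card _ _ _ (by omega), zero_mul]
        · simp
      · simp
    · intro h
      exfalso
      apply h
      rw [Finset.HasAntidiagonal.mem_antidiagonal, hn]
      ring
  have hfg : f = Polynomial.C (PowerSeries.coeff (2 ^ n) G) * g := by
    have hinj : Set.InjOn (fun t : Finset ι => ∑ i ∈ t, x i) E :=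
      hx.mono fun t ht => (Finset.mem_filter.1 ht).1
    refine Polynomial.eq_of_degree_sub_lt_of_eval_finset_eq
      (E.image fun t => ∑ i ∈ t, x i) ?_ ?_
    · rw [Finset.card_image_of_injOn hinj, hE, degree_lt_iff_coeff_zero]
      intro m hm
      rw [Polynomial.coeff_sub, Polynomial.coeff_C_mul, hcoeff m hm]
      split_ifs with h
      · rw [h, ← hgd, hgm.coeff_natDegree, mul_one, sub_self]
      · rw [coeff_eq_zero_of_natDegree_lt (by omega), mul_zero, sub_zero]
    · intro b hb
      obtain ⟨t, ht, rfl⟩ := Finset.mem_image.1 hb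
      have ht' := Finset.mem_filter.1 ht
      rw [hf, coeff_twoPowSeries_sum_mul_prod_eq_zero x (Finset.mem_powerset.1 ht'.1) ht'.2,
        Polynomial.eval_mul, Polynomial.eval_prod, Finset.prod_eq_zero ht, mul_zero]
      rw [Polynomial.eval_sub, Polynomial.eval_X, Polynomial.eval_C, sub_self]
  rw [← hf, hfg, hn, Nat.add_sub_cancel, Polynomial.eval_mul, Polynomial.eval_C, Polynomial.eval_prod]
  simp only [E, Polynomial.eval_add, Polynomial.eval_X, Polynomial.eval_C, CharTwo.sub_eq_add]

theorem prod_odd_sums_eq_coeff [IsDomain R] {ι : Type*} (x : ι → R) {s : Finset ι}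
    (hs : s.Nonempty) (hx : Set.InjOn (fun t : Finset ι => ∑ i ∈ t, x i) s.powerset) :
    ∏ t ∈ s.powerset with Odd t.card, ∑ i ∈ t, x i =
      PowerSeries.coeff (2 ^ (s.card - 1)) (∏ i ∈ s, twoPowSeries (x i)) := by
  classical
  induction hs using Finset.Nonempty.cons_induction with
  | singleton a =>
    rw [Finset.prod_filter, ← insert_empty_eq, Finset.prod_powerset_insert (by simp)]
    simp [coeff_twoPowSeries]
  | cons a s ha hs ih =>
    rw [Finset.cons_eq_insert] at *
    rw [Finset.prod_filter, Finset.prod_powerset_insert ha, Finset.prod_insert ha,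
      Finset.card_insert_of_notMem ha, Nat.add_sub_cancel]
    have hx' : Set.InjOn (fun t : Finset ι => ∑ i ∈ t, x i) s.powerset :=
      hx.mono (by exact_mod_cast Finset.powerset_mono.2 (Finset.subset_insert a s))
    rw [coeff_twoPowSeries_mul_prod x hs hx', ← ih hx', Finset.prod_filter, Finset.prod_filter]
    congr 1
    refine Finset.prod_congr rfl fun t ht => ?_
    have hat : a ∉ t := fun h => ha (Finset.mem_powerset.1 ht h)
    rw [Finset.card_insert_of_notMem hat, Finset.sum_insert hat]
    exact if_congr (by simp [Nat.odd_add_one]) rfl rfl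

end

theorem MvPolynomial.injective_sum_X {σ R : Type*} [CommSemiring R] [Nontrivial R] :
    Function.Injective fun t : Finset σ => ∑ i ∈ t, (X i : MvPolynomial σ R) := by
  classical
  intro s t h
  ext i
  have := congrArg (coeff (Finsupp.single i 1)) h
  simp only [coeff_sum, coeff_X, Finsupp.single_left_inj one_ne_zero, Finset.sum_ite_eq'] at this
  by_cases hs : i ∈ s <;> by_cases ht : i ∈ t <;> simp_all

theorem coeff_prod_twoPowSeries_eq_finsum {R ι : Type*} [CommRing R] [Fintype ι] (x : ι → R)
    (N : ℕ) :
    PowerSeries.coeff N (∏ i, twoPowSeries (x i)) =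
      ∑ᶠ r ∈ {r : ι → ℕ | (∑ i, 2 ^ r i) = N}, ∏ i, x i ^ 2 ^ r i := by
  classical
  rw [PowerSeries.coeff_prod]
  have hterm : ∀ l : ι →₀ ℕ, ∏ i, PowerSeries.coeff (l i) (twoPowSeries (x i)) =
      if ∀ i, ∃ r, 2 ^ r = l i then ∏ i, x i ^ l i else 0 := by
    intro l
    simp only [coeff_twoPowSeries]
    split_ifs with h
    · exact Finset.prod_congr rfl fun i _ => if_pos (h i)
    · push Not at h
      obtain ⟨i, hi⟩ := h
      exact Finset.prod_eq_zero (Finset.mem_univ i) (if_neg (by simpa using hi))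
  simp only [hterm]
  rw [← Finset.sum_filter, ← finsum_mem_coe_finset]
  symm
  refine finsum_mem_eq_of_bijOn
    (fun r : ι → ℕ => Finsupp.equivFunOnFinite.symm fun i => 2 ^ r i) ⟨?_, ?_, ?_⟩ ?_
  · intro r hr
    simpa using hr
  · intro r _ r' _ h
    funext i
    exact Nat.pow_right_injective le_rfl (DFunLike.congr_fun h i)
  · intro l hl
    simp only [Finset.coe_filter, Finset.mem_finsuppAntidiag, Set.mem_ofPred_eq] at hl
    choose r hr using hl.2
    exact ⟨r, by simpa [hr] using hl.1.1, by ext i; exact hr i⟩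
  · intro r _
    rfl

/-- In `𝔽₂[x_1, …, x_n]` (`n ≥ 1`),
`∏_{S ⊆ {1,…,n}, |S| odd} σ_S = ∑ x_1^{2^{r_1}}·⋯·x_n^{2^{r_n}}`, the sum running over all
`n`-tuples `(r_1, …, r_n)` of nonnegative integers with `2^{r_1} + ⋯ + 2^{r_n} = 2^{n−1}`. -/
theorem prod_odd_sums_eq_sum_of_two_powers (n : ℕ) (hn : 1 ≤ n) :
    (∏ S ∈ Finset.univ.filter (fun S : Finset (Fin n) => Odd S.card),
        (∑ i ∈ S, (X i : MvPolynomial (Fin n) (ZMod 2))))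
      = ∑ᶠ r ∈ {r : Fin n → ℕ | (∑ i, 2 ^ r i) = 2 ^ (n - 1)},
          ∏ i, (X i : MvPolynomial (Fin n) (ZMod 2)) ^ 2 ^ r i := by
  have : NeZero n := ⟨by omega⟩
  rw [← coeff_prod_twoPowSeries_eq_finsum, ← Finset.powerset_univ,
    prod_odd_sums_eq_coeff _ Finset.univ_nonempty MvPolynomial.injective_sum_X.injOn,
    Finset.card_univ, Fintype.card_fin]
end

section
/- Let f ≥ 1 and i ≥ 1 be integers with i ≤ 2^{f−1}, and let k be the unique nonnegative integer with 2^k ≤ i < 2^{k+1}. If k ≤ f − 1, then 2^{f−1−k} divides the binomial coefficient C(2^{f−1}, i). -/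
/-- Let `f ≥ 1` and `i ≥ 1` be integers with `i ≤ 2^{f−1}`, and let `k` be
the unique nonnegative integer with `2^k ≤ i < 2^{k+1}`.  If `k ≤ f − 1`, then
`2^{f−1−k}` divides the binomial coefficient `C(2^{f−1}, i)`. -/
theorem two_pow_dvd_choose_two_pow (f i k : ℕ) (hf : 1 ≤ f) (hi : 1 ≤ i)
    (hi2 : i ≤ 2 ^ (f - 1)) (hk1 : 2 ^ k ≤ i) (hk2 : i < 2 ^ (k + 1)) (hkf : k ≤ f - 1) :
    2 ^ (f - 1 - k) ∣ Nat.choose (2 ^ (f - 1)) i := by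
  have hi0 : i ≠ 0 := Nat.one_le_iff_ne_zero.mp hi
  have hik : i.factorization 2 < k + 1 :=
    (Nat.pow_lt_pow_iff_right Nat.one_lt_two).mp ((Nat.ordProj_le 2 hi0).trans_lt hk2)
  rw [Nat.prime_two.pow_dvd_iff_le_factorization (Nat.choose_ne_zero hi2),
    Nat.factorization_choose_prime_pow Nat.prime_two hi2 hi0]
  exact Nat.sub_le_sub_left (Nat.lt_succ_iff.mp hik) (f - 1)
end
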